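/- Let Σ be a set of identities and V = Mod(Σ) the variety it axiomatizes. If every member of V is abelian and some member of V is not affine (i.e., some member of V has no Maltsev polynomial operation), then there exist an algebra B in V and a nontrivial strongly abelian congruence on B. -/

import Mathlib

namespace UA

/-- An algebraic language: a type of operation symbols with arities. -/
structure Lang where
  F : Type
  arity : F → ℕ

variable {L : Lang}

/-- An interpretation of the language `L` on the carrier `A` (an algebra structure). -/
def Interp (L : Lang) (A : Type) : Type :=
  (f : L.F) → ((Fin (L.arity f)) → A) → A

/-- Terms of the language `L` over a type `X` of variables. -/
inductive Term (L : Lang) (X : Type) : Type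
  | var : X → Term L X
  | app : (f : L.F) → ((Fin (L.arity f)) → Term L X) → Term L X

/-- Realization of a term under an assignment of the variables. -/
def Term.realize {A X : Type} (I : Interp L A) (v : X → A) : Term L X → A
  | .var x => v x
  | .app f ts => I f (fun i => (ts i).realize I v)

/-- Relabelling (substitution of variables) of terms. -/
def Term.relabel {X Y : Type} (g : X → Y) : Term L X → Term L Y
  | .var x => .var (g x)
  | .app f ts => .app f (fun i => (ts i).relabel g)

/-- `p` is a polynomial operation of the algebra `(A, I)` with argument-index type `X`:
it is the realization of a term in variables `X ⊕ Fin m` where the `Fin m` variables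
are evaluated at fixed constants. -/
def IsPolyOp {A X : Type} (I : Interp L A) (p : (X → A) → A) : Prop :=
  ∃ (m : ℕ) (t : Term L (X ⊕ Fin m)) (c : Fin m → A),
    ∀ x : X → A, p x = t.realize I (Sum.elim x c)

/-- A unary polynomial operation. -/
def IsUnaryPolyOp {A : Type} (I : Interp L A) (g : A → A) : Prop :=
  IsPolyOp I (fun x : Fin 1 → A => g (x 0))

/-- `(p, q, r, s)` is a `1,1`-matrix of the algebra `(A, I)`. -/
def Is11Matrix {A : Type} (I : Interp L A) (p q r s : A) : Prop :=
  ∃ (k l : ℕ) (t : ((Fin k ⊕ Fin l) → A) → A), IsPolyOp I t ∧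
    ∃ (a b : Fin k → A) (u v : Fin l → A),
      p = t (Sum.elim a u) ∧ q = t (Sum.elim a v) ∧
      r = t (Sum.elim b u) ∧ s = t (Sum.elim b v)

/-- The algebra is abelian: in every `1,1`-matrix, `p = q` implies `r = s`. -/
def IsAbelian {A : Type} (I : Interp L A) : Prop :=
  ∀ p q r s : A, Is11Matrix I p q r s → p = q → r = s

/-- The algebra is strongly rectangular: in every `1,1`-matrix, `q = r` implies `r = s`. -/
def IsStronglyRectangular {A : Type} (I : Interp L A) : Prop :=
  ∀ p q r s : A, Is11Matrix I p q r s → q = r → r = s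

/-- Strongly abelian = abelian + strongly rectangular. -/
def IsStronglyAbelian {A : Type} (I : Interp L A) : Prop :=
  IsAbelian I ∧ IsStronglyRectangular I

/-- The algebra has a Maltsev polynomial operation. -/
def HasMaltsevPoly {A : Type} (I : Interp L A) : Prop :=
  ∃ mOp : (Fin 3 → A) → A, IsPolyOp I mOp ∧
    ∀ x y : A, mOp ![x, y, y] = x ∧ mOp ![y, y, x] = x

/-- Affine = abelian + has a Maltsev polynomial operation. -/
def IsAffine {A : Type} (I : Interp L A) : Prop :=
  IsAbelian I ∧ HasMaltsevPoly I

/-- The algebra satisfies the identity `e.1 ≈ e.2`. -/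
def Satisfies {A : Type} (I : Interp L A) (e : Term L ℕ × Term L ℕ) : Prop :=
  ∀ v : ℕ → A, e.1.realize I v = e.2.realize I v

/-- Membership in the variety `Mod(E)` axiomatized by the set `E` of identities. -/
def InVariety {A : Type} (E : Set (Term L ℕ × Term L ℕ)) (I : Interp L A) : Prop :=
  ∀ e ∈ E, Satisfies I e

/-- `θ` is a congruence on the algebra `(A, I)`. -/
def IsCong {A : Type} (I : Interp L A) (θ : A → A → Prop) : Prop :=
  Equivalence θ ∧
    ∀ (f : L.F) (a b : Fin (L.arity f) → A),
      (∀ i, θ (a i) (b i)) → θ (I f a) (I f b)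

/-- `(p, q, r, s)` is a `θ`-matrix of the algebra `(A, I)`. -/
def IsThetaMatrix {A : Type} (I : Interp L A) (θ : A → A → Prop) (p q r s : A) : Prop :=
  ∃ (k l : ℕ) (t : ((Fin k ⊕ Fin l) → A) → A), IsPolyOp I t ∧
    ∃ (a b : Fin k → A) (u v : Fin l → A),
      (∀ i, θ (a i) (b i)) ∧ (∀ j, θ (u j) (v j)) ∧
      p = t (Sum.elim a u) ∧ q = t (Sum.elim a v) ∧
      r = t (Sum.elim b u) ∧ s = t (Sum.elim b v)

/-- `θ` is a strongly abelian congruence. -/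
def IsStronglyAbelianCong {A : Type} (I : Interp L A) (θ : A → A → Prop) : Prop :=
  ∀ p q r s : A, IsThetaMatrix I θ p q r s → (p = q → r = s) ∧ (q = r → r = s)

/-- `S` is a subuniverse of the algebra `(A, I)`. -/
def IsSubuniverse {A : Type} (I : Interp L A) (S : Set A) : Prop :=
  ∀ (f : L.F) (a : Fin (L.arity f) → A), (∀ i, a i ∈ S) → I f a ∈ S

/-- The substructure (restricted algebra structure) on a subuniverse. -/
def subInterp {A : Type} (I : Interp L A) (S : Set A) (hS : IsSubuniverse I S) :
    Interp L S :=
  fun f a => ⟨I f (fun i => (a i : A)), hS f _ (fun i => (a i).2)⟩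

/-- The componentwise algebra structure on a product. -/
def prodInterp {ι : Type} {A : ι → Type} (I : ∀ i, Interp L (A i)) :
    Interp L (∀ i, A i) :=
  fun f a i => I i f (fun j => a j i)

/-- The componentwise algebra structure on `A × A`. -/
def pairInterp {A : Type} (I : Interp L A) : Interp L (A × A) :=
  fun f a => (I f (fun i => (a i).1), I f (fun i => (a i).2))

/-- `h` is a homomorphism of `L`-algebras. -/
def IsHom {A B : Type} (I : Interp L A) (J : Interp L B) (h : A → B) : Prop :=
  ∀ (f : L.F) (a : Fin (L.arity f) → A), h (I f a) = J f (fun i => h (a i))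

/-- The induced algebra structure on the quotient by a congruence `ρ`
(well-defined, i.e. independent of the chosen representatives, when `ρ` is a congruence). -/
noncomputable def quotInterp {A : Type} (I : Interp L A) (ρ : A → A → Prop) :
    Interp L (Quot ρ) :=
  fun f a => Quot.mk ρ (I f (fun i => (a i).out))

/-- The subuniverse generated by a subset `G`: the intersection of all
subuniverses containing `G`. -/
def GenSub {A : Type} (I : Interp L A) (G : Set A) : Set A :=
  {x | ∀ S : Set A, IsSubuniverse I S → G ⊆ S → x ∈ S}

theorem genSub_isSubuniverse {A : Type} (I : Interp L A) (G : Set A) :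
    IsSubuniverse I (GenSub I G) :=
  fun f a ha S hS hG => hS f a (fun i => ha i S hS hG)

/-- The smallest congruence containing the pair `(x, y)`: the intersection of all
congruences containing it. -/
def genCong {A : Type} (I : Interp L A) (x y : A) : A → A → Prop :=
  fun w z => ∀ ρ : A → A → Prop, IsCong I ρ → ρ x y → ρ w z

/-- The carrier of `A(θ)`, the graph of `θ` inside `A × A`. -/
abbrev ThetaSub {A : Type} (θ : A → A → Prop) : Type := {z : A × A // θ z.1 z.2}

/-- The substructure `A(θ) ≤ A × A` supported by the graph of `θ`. -/
def thetaSubInterp {A : Type} (I : Interp L A) (θ : A → A → Prop) (hθ : IsCong I θ) :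
    Interp L (ThetaSub θ) :=
  fun f a => ⟨(I f (fun i => (a i).1.1), I f (fun i => (a i).1.2)),
    hθ.2 f _ _ (fun i => (a i).2)⟩

/-- The diagonal element `(c, c)` of `A(θ)`. -/
def diagEl {A : Type} {θ : A → A → Prop} (hrefl : ∀ a : A, θ a a) (c : A) :
    ThetaSub θ := ⟨(c, c), hrefl c⟩

/-- `Δ`: the smallest congruence of `A(θ)` containing `D × D`, where `D` is the
diagonal -- the intersection of all congruences of `A(θ)` containing `D × D`. -/
def DeltaRel {A : Type} (I : Interp L A) (θ : A → A → Prop) (hθ : IsCong I θ) :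
    ThetaSub θ → ThetaSub θ → Prop :=
  fun x y => ∀ ρ : ThetaSub θ → ThetaSub θ → Prop,
    IsCong (thetaSubInterp I θ hθ) ρ →
    (∀ c d : A, ρ (diagEl hθ.1.refl c) (diagEl hθ.1.refl d)) → ρ x y

/-- The quotient algebra `S = A(θ)/Δ`. -/
noncomputable def SInterp {A : Type} (I : Interp L A) (θ : A → A → Prop)
    (hθ : IsCong I θ) : Interp L (Quot (DeltaRel I θ hθ)) :=
  quotInterp (thetaSubInterp I θ hθ) (DeltaRel I θ hθ)

/-- The element `0` of `S = A(θ)/Δ`: the `Δ`-class of a diagonal element. -/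
def zeroS {A : Type} (I : Interp L A) (θ : A → A → Prop) (hθ : IsCong I θ) (d : A) :
    Quot (DeltaRel I θ hθ) :=
  Quot.mk _ (diagEl hθ.1.refl d)

/-- The diagonal of `B × B`. -/
def diagSet (B : Type) : Set (B × B) := {z | z.1 = z.2}

/-- The set of pairs `(u j, v j)`. -/
def pairsSet {B : Type} {l : ℕ} (u v : Fin l → B) : Set (B × B) :=
  {z | ∃ j, z = (u j, v j)}

/-- The carrier of the subalgebra `C ≤ B × B` generated by the diagonal and the
pairs `(u j, v j)`. -/
def CsetOf {L : Lang} {B : Type} (I : Interp L B) {l : ℕ} (u v : Fin l → B) :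
    Set (B × B) :=
  GenSub (pairInterp I) (diagSet B ∪ pairsSet u v)

/-- The subalgebra `C ≤ B × B` generated by the diagonal and the pairs `(u j, v j)`. -/
def CInterpOf {L : Lang} {B : Type} (I : Interp L B) {l : ℕ} (u v : Fin l → B) :
    Interp L (CsetOf I u v) :=
  subInterp (pairInterp I) _ (genSub_isSubuniverse _ _)


/-! ### Substitution -/

/-- The term algebra. -/
def termInterp (L : Lang) (X : Type) : Interp L (Term L X) := Term.app

/-- Simultaneous substitution of terms for variables. -/
def Term.subst {X Y : Type} (t : Term L X) (σ : X → Term L Y) : Term L Y :=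
  t.realize (termInterp L Y) σ

@[simp] theorem Term.subst_var {X Y : Type} (x : X) (σ : X → Term L Y) :
    (Term.var x).subst σ = σ x := rfl

@[simp] theorem Term.subst_app {X Y : Type} (f : L.F) (ts : Fin (L.arity f) → Term L X)
    (σ : X → Term L Y) : (Term.app f ts).subst σ = .app f (fun i => (ts i).subst σ) := rfl

theorem Term.realize_subst {A X Y : Type} (I : Interp L A) (t : Term L X) (σ : X → Term L Y)
    (v : Y → A) : (t.subst σ).realize I v = t.realize I (fun x => (σ x).realize I v) := by
  induction t with
  | var x => rfl
  | app f ts ih =>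
    simp only [Term.subst_app, Term.realize]
    congr 1
    funext i
    exact ih i

theorem Term.subst_subst {X Y Z : Type} (t : Term L X) (σ : X → Term L Y) (τ : Y → Term L Z) :
    (t.subst σ).subst τ = t.subst (fun x => (σ x).subst τ) :=
  t.realize_subst (termInterp L Z) σ τ

@[simp] theorem Term.subst_id {X : Type} (t : Term L X) : t.subst Term.var = t := by
  induction t with
  | var x => rfl
  | app f ts ih => simp only [Term.subst_app, ih]

theorem Term.exists_finite_support {Z : Type} (t : Term L Z) :
    ∃ (n : ℕ) (t' : Term L (Fin n)) (g : Fin n → Z), t = t'.subst (fun i => .var (g i)) := by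
  induction t with
  | var z => exact ⟨1, .var 0, fun _ => z, rfl⟩
  | app f ts ih =>
    choose n t' g h using ih
    let e := Fintype.equivFin ((i : Fin (L.arity f)) × Fin (n i))
    refine ⟨_, .app f (fun i => (t' i).subst (fun j => .var (e ⟨i, j⟩))),
      fun k => g (e.symm k).1 (e.symm k).2, ?_⟩
    simp only [Term.subst_app, Term.subst_subst, Term.subst_var]
    congr 1
    funext i
    refine (h i).trans (congrArg (t' i).subst (funext fun j => ?_))
    exact congrArg (fun p : (i : Fin (L.arity f)) × Fin (n i) => Term.var (g p.1 p.2))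
      (e.symm_apply_apply ⟨i, j⟩).symm

/-- The term condition for an abelian algebra, for assignments indexed by an arbitrary type. -/
theorem IsAbelian.term_condition {A Z : Type} {I : Interp L A} (hA : IsAbelian I) (t : Term L Z)
    (v₀₀ v₀₁ v₁₀ v₁₁ : Z → A)
    (hv : ∀ z, (v₀₀ z = v₀₁ z ∧ v₁₀ z = v₁₁ z) ∨ (v₀₀ z = v₁₀ z ∧ v₀₁ z = v₁₁ z))
    (h : t.realize I v₀₀ = t.realize I v₀₁) : t.realize I v₁₀ = t.realize I v₁₁ := by
  classical
  obtain ⟨n, t', g, rfl⟩ := t.exists_finite_support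
  let side : Fin n → Fin n ⊕ Fin n := fun i =>
    if v₀₀ (g i) = v₀₁ (g i) ∧ v₁₀ (g i) = v₁₁ (g i) then .inl i else .inr i
  refine hA _ _ _ _ ⟨n, n, fun x => (t'.subst (fun i => .var (side i))).realize I x,
    ⟨0, t'.subst (fun i => .var (.inl (side i))), Fin.elim0, fun x => ?_⟩,
    fun i => v₀₀ (g i), fun i => v₁₀ (g i), fun i => v₀₀ (g i), fun i => v₀₁ (g i),
    ?_, ?_, ?_, ?_⟩ h
  · simp only [Term.realize_subst, Term.realize, Sum.elim_inl]
  all_goals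
    simp only [Term.realize_subst, Term.realize]
    congr 1
    funext i
    by_cases hi : v₀₀ (g i) = v₀₁ (g i) ∧ v₁₀ (g i) = v₁₁ (g i)
    · have hs : side i = .inl i := if_pos hi
      simp [hs, hi]
    · have hs : side i = .inr i := if_neg hi
      have := (hv (g i)).resolve_left hi
      simp [hs, this]

/-- A preorder that is compatible in each argument separately is compatible. -/
theorem compatible_of_update {A : Type} {I : Interp L A} {ρ : A → A → Prop}
    (hrefl : ∀ a, ρ a a) (htrans : ∀ a b c, ρ a b → ρ b c → ρ a c)
    (hupd : ∀ (f : L.F) (a : Fin (L.arity f) → A) i w,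
      ρ (a i) w → ρ (I f a) (I f (Function.update a i w)))
    (f : L.F) (a b : Fin (L.arity f) → A) (hab : ∀ i, ρ (a i) (b i)) :
    ρ (I f a) (I f b) := by
  have key : ∀ s : Finset (Fin (L.arity f)), ρ (I f a) (I f (s.piecewise b a)) := by
    intro s
    induction s using Finset.induction_on with
    | empty => simpa using hrefl _
    | insert j s hj ih =>
      rw [Finset.piecewise_insert]
      refine htrans _ _ _ ih (hupd f _ j _ ?_)
      simpa [hj] using hab j
  simpa using key Finset.univ

/-! ### Identities of the variety and congruences of the term algebra -/

section Variety

variable (E : Set (Term L ℕ × Term L ℕ))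

/-- `s ≈ t` is an identity of `Mod(E)`. -/
def EqV {X : Type} (s t : Term L X) : Prop :=
  ∀ (A : Type) (I : Interp L A), InVariety E I → ∀ v : X → A, s.realize I v = t.realize I v

variable {E}

theorem EqV.refl {X : Type} (s : Term L X) : EqV E s s := fun _ _ _ _ => rfl

theorem EqV.symm {X : Type} {s t : Term L X} (h : EqV E s t) : EqV E t s :=
  fun A I hI v => (h A I hI v).symm

theorem EqV.trans {X : Type} {s t u : Term L X} (h : EqV E s t) (h' : EqV E t u) : EqV E s u :=
  fun A I hI v => (h A I hI v).trans (h' A I hI v)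

theorem EqV.subst {X Y : Type} {s t : Term L X} (h : EqV E s t) (σ : X → Term L Y) :
    EqV E (s.subst σ) (t.subst σ) := fun A I hI v => by
  simpa only [Term.realize_subst] using h A I hI _

theorem EqV.subst_congr {X Y : Type} (t : Term L X) {σ τ : X → Term L Y}
    (h : ∀ x, EqV E (σ x) (τ x)) : EqV E (t.subst σ) (t.subst τ) := fun A I hI v => by
  simp only [Term.realize_subst, fun x => h x A I hI v]

variable (E)

/-- A compatible preorder on a term algebra containing the identities of `Mod(E)`. -/
structure IsVPreorder {X : Type} (θ : Term L X → Term L X → Prop) : Prop where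
  of_eqV : ∀ {s t}, EqV E s t → θ s t
  trans : ∀ {s t u}, θ s t → θ t u → θ s u
  compat : ∀ (f : L.F) (a b : Fin (L.arity f) → Term L X),
    (∀ i, θ (a i) (b i)) → θ (.app f a) (.app f b)

/-- A congruence of a term algebra containing the identities of `Mod(E)`. -/
structure IsVCong {X : Type} (θ : Term L X → Term L X → Prop) : Prop
    extends IsVPreorder E θ where
  symm : ∀ {s t}, θ s t → θ t s

variable {E}

theorem IsVPreorder.refl {X : Type} {θ : Term L X → Term L X → Prop} (hθ : IsVPreorder E θ)
    (s : Term L X) : θ s s := hθ.of_eqV (.refl s)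

theorem IsVPreorder.subst {X Z : Type} {θ : Term L X → Term L X → Prop} (hθ : IsVPreorder E θ)
    (t : Term L Z) {σ τ : Z → Term L X} (h : ∀ z, θ (σ z) (τ z)) :
    θ (t.subst σ) (t.subst τ) := by
  induction t with
  | var z => exact h z
  | app f ts ih => exact hθ.compat f _ _ ih

theorem isVCong_eqV {X : Type} : IsVCong E (EqV E (X := X)) where
  of_eqV h := h
  trans := EqV.trans
  symm := EqV.symm
  compat f a b h := fun A I hI v => by
    simp only [Term.realize, fun i => h i A I hI v]

/-- The equivalence relation associated with a compatible preorder is a congruence. -/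
theorem IsVPreorder.isVCong_antisymm {X : Type} {θ : Term L X → Term L X → Prop}
    (hθ : IsVPreorder E θ) : IsVCong E (fun s t => θ s t ∧ θ t s) where
  of_eqV h := ⟨hθ.of_eqV h, hθ.of_eqV h.symm⟩
  trans h h' := ⟨hθ.trans h.1 h'.1, hθ.trans h'.2 h.2⟩
  symm h := ⟨h.2, h.1⟩
  compat f a b h := ⟨hθ.compat f a b fun i => (h i).1, hθ.compat f b a fun i => (h i).2⟩

namespace IsVCong

variable {X : Type} {θ : Term L X → Term L X → Prop}

theorem mk_eq_mk (hθ : IsVCong E θ) {s t : Term L X} :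
    Quot.mk θ s = Quot.mk θ t ↔ θ s t := by
  have he : Equivalence θ := ⟨hθ.refl, hθ.symm, hθ.trans⟩
  exact (Quot.eq.trans he.eqvGen_iff)

theorem out_mk (hθ : IsVCong E θ) (s : Term L X) : θ (Quot.mk θ s).out s :=
  hθ.mk_eq_mk.1 (Quot.out_eq _)

theorem realize_mk (hθ : IsVCong E θ) {Z : Type} (t : Term L Z) (σ : Z → Term L X) :
    t.realize (quotInterp (termInterp L X) θ) (fun z => Quot.mk θ (σ z)) =
      Quot.mk θ (t.subst σ) := by
  induction t with
  | var z => rfl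
  | app f ts ih =>
    simp only [Term.realize, ih, quotInterp]
    exact hθ.mk_eq_mk.2 (hθ.compat f _ _ fun i => hθ.out_mk _)

theorem realize_eq (hθ : IsVCong E θ) {Z : Type} (t : Term L Z) (v : Z → Quot θ) :
    t.realize (quotInterp (termInterp L X) θ) v = Quot.mk θ (t.subst fun z => (v z).out) := by
  simpa only [Quot.out_eq] using hθ.realize_mk t fun z => (v z).out

theorem inVariety (hθ : IsVCong E θ) : InVariety E (quotInterp (termInterp L X) θ) := by
  intro e he v
  rw [hθ.realize_eq, hθ.realize_eq, hθ.mk_eq_mk]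
  refine hθ.of_eqV fun A I hI w => ?_
  simpa only [Term.realize_subst] using hI e he _

theorem term_condition (hθ : IsVCong E θ)
    (hab : ∀ (A : Type) (I : Interp L A), InVariety E I → IsAbelian I)
    {Z : Type} (t : Term L Z) (σ₀₀ σ₀₁ σ₁₀ σ₁₁ : Z → Term L X)
    (hσ : ∀ z, (θ (σ₀₀ z) (σ₀₁ z) ∧ θ (σ₁₀ z) (σ₁₁ z)) ∨
      (θ (σ₀₀ z) (σ₁₀ z) ∧ θ (σ₀₁ z) (σ₁₁ z)))
    (h : θ (t.subst σ₀₀) (t.subst σ₀₁)) : θ (t.subst σ₁₀) (t.subst σ₁₁) := by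
  have := (hab _ _ hθ.inVariety).term_condition t
    (fun z => Quot.mk θ (σ₀₀ z)) (fun z => Quot.mk θ (σ₀₁ z))
    (fun z => Quot.mk θ (σ₁₀ z)) (fun z => Quot.mk θ (σ₁₁ z))
  simp only [hθ.realize_mk, hθ.mk_eq_mk] at this
  exact this hσ h

end IsVCong

end Variety

/-! ### Contexts and the largest compatible relation inside a given preorder -/

/-- Plugging a term into the hole `none` of a one-hole context. -/
def plug {X : Type} (c : Term L (Option X)) (u : Term L X) : Term L X :=
  c.subst (fun o => o.elim u .var)

/-- The largest compatible relation contained in the preorder `ρ`. -/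
def Core {X : Type} (ρ : Term L X → Term L X → Prop) (u v : Term L X) : Prop :=
  ∀ c : Term L (Option X), ρ (plug c u) (plug c v)

theorem Core.le {X : Type} {ρ : Term L X → Term L X → Prop} {u v : Term L X}
    (h : Core ρ u v) : ρ u v := h (.var none)

theorem exists_plug_update {X : Type} (c : Term L (Option X)) (f : L.F)
    (a : Fin (L.arity f) → Term L X) (i : Fin (L.arity f)) :
    ∃ c' : Term L (Option X), ∀ u, plug c' u = plug c (.app f (Function.update a i u)) := by
  refine ⟨c.subst fun o => o.elim (.app f (Function.update
    (fun j => (a j).subst fun x => .var (some x)) i (.var none))) fun x => .var (some x),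
    fun u => ?_⟩
  simp only [plug, Term.subst_subst]
  congr 1
  funext o
  cases o with
  | some x => rfl
  | none =>
    simp only [Option.elim, Term.subst_app]
    congr 1
    funext j
    by_cases hj : j = i
    · subst hj; simp
    · simp only [Function.update_of_ne hj, Term.subst_subst, Term.subst_var]
      exact (a j).subst_id

theorem isVPreorder_core {X : Type} {E : Set (Term L ℕ × Term L ℕ)}
    {ρ : Term L X → Term L X → Prop} (hE : ∀ s t, EqV E s t → ρ s t)
    (htrans : ∀ s t u, ρ s t → ρ t u → ρ s u) : IsVPreorder E (Core ρ) where
  of_eqV {s t} h c := hE _ _ (EqV.subst_congr c fun o => by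
    cases o
    · exact h
    · exact .refl _)
  trans h h' c := htrans _ _ _ (h c) (h' c)
  compat := compatible_of_update (I := termInterp L X)
    (fun a c => hE _ _ (.refl _)) (fun a b c h h' d => htrans _ _ _ (h d) (h' d))
    fun f a i w h c => by
      obtain ⟨c', hc'⟩ := exists_plug_update c f a i
      have := h c'
      rw [hc', hc', Function.update_eq_self] at this
      exact this

theorem isVCong_core {X : Type} {E : Set (Term L ℕ × Term L ℕ)}
    {ρ : Term L X → Term L X → Prop} (hE : ∀ s t, EqV E s t → ρ s t)
    (htrans : ∀ s t u, ρ s t → ρ t u → ρ s u) (hsymm : ∀ s t, ρ s t → ρ t s) :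
    IsVCong E (Core ρ) where
  toIsVPreorder := isVPreorder_core hE htrans
  symm h c := hsymm _ _ (h c)

/-! ### Binary terms -/

/-- The value of a binary term at `(h, l)`; the variable `true` is the first one. -/
def Term.eval₂ {X : Type} (s : Term L Bool) (h l : Term L X) : Term L X :=
  s.subst (fun b => bif b then h else l)

@[simp] theorem Term.eval₂_self (s : Term L Bool) : s.eval₂ (.var true) (.var false) = s := by
  have : (fun b : Bool => bif b then (.var true : Term L Bool) else .var false) = .var := by
    funext b; cases b <;> rfl
  rw [Term.eval₂, this, Term.subst_id]

theorem Term.subst_eval₂ {X Y : Type} (s : Term L Bool) (h l : Term L X) (σ : X → Term L Y) :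
    (s.eval₂ h l).subst σ = s.eval₂ (h.subst σ) (l.subst σ) := by
  rw [eval₂, eval₂, subst_subst]
  congr 1
  funext b
  cases b <;> rfl

theorem Term.eval₂_eval₂ {X : Type} (s h l : Term L Bool) (h' l' : Term L X) :
    (s.eval₂ h l).eval₂ h' l' = s.eval₂ (h.eval₂ h' l') (l.eval₂ h' l') :=
  s.subst_eval₂ h l _

theorem Term.eval₂_subst {X Z : Type} (t : Term L Z) (σ : Z → Term L Bool) (h l : Term L X) :
    (t.subst σ).eval₂ h l = t.subst (fun z => (σ z).eval₂ h l) :=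
  t.subst_subst σ _

section Binary

variable (E : Set (Term L ℕ × Term L ℕ))

/-- The binary terms `s`, `t` become equal after identifying the two variables. -/
def DiagEq (s t : Term L Bool) : Prop :=
  EqV E (s.eval₂ (.var false) (.var false) : Term L Bool) (t.eval₂ (.var false) (.var false))

/-- The binary term `s` is idempotent in `Mod(E)`. -/
def IsIdem (s : Term L Bool) : Prop :=
  EqV E (s.eval₂ (.var false) (.var false) : Term L Bool) (.var false)

variable {E}

theorem DiagEq.refl (s : Term L Bool) : DiagEq E s s := EqV.refl _

theorem DiagEq.symm {s t : Term L Bool} (h : DiagEq E s t) : DiagEq E t s := EqV.symm h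

theorem DiagEq.trans {s t u : Term L Bool} (h : DiagEq E s t) (h' : DiagEq E t u) :
    DiagEq E s u := EqV.trans h h'

theorem DiagEq.of_eqV {s t : Term L Bool} (h : EqV E s t) : DiagEq E s t := h.subst _

theorem DiagEq.eval₂ {X : Type} {s t : Term L Bool} (h : DiagEq E s t) (w : Term L X) :
    EqV E (s.eval₂ w w) (t.eval₂ w w) := by
  simpa only [Term.subst_eval₂, Term.subst_var] using EqV.subst h (fun _ => w)

theorem DiagEq.subst {Z : Type} (t : Term L Z) {σ τ : Z → Term L Bool}
    (h : ∀ z, DiagEq E (σ z) (τ z)) : DiagEq E (t.subst σ) (t.subst τ) := by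
  unfold DiagEq
  rw [Term.eval₂_subst, Term.eval₂_subst]
  exact EqV.subst_congr t h

theorem IsIdem.congr {s t : Term L Bool} (hs : IsIdem E s) (h : DiagEq E s t) : IsIdem E t :=
  EqV.trans (EqV.symm h) hs

theorem IsIdem.diagEq {s t : Term L Bool} (hs : IsIdem E s) (ht : IsIdem E t) : DiagEq E s t :=
  EqV.trans hs (EqV.symm ht)

theorem isIdem_var (b : Bool) : IsIdem E (.var b : Term L Bool) := by
  cases b <;> exact EqV.refl _

theorem IsIdem.eval₂ {X : Type} {s : Term L Bool} (hs : IsIdem E s) (w : Term L X) :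
    EqV E (s.eval₂ w w) w := DiagEq.eval₂ (t := .var false) hs w

theorem IsIdem.eval₂_isIdem {s t u : Term L Bool} (hs : IsIdem E s) (ht : IsIdem E t)
    (hu : IsIdem E u) : IsIdem E (s.eval₂ t u) := by
  refine IsIdem.congr (s := s.eval₂ (.var false) (.var false)) ?_ ?_
  · unfold IsIdem
    rw [Term.eval₂_eval₂]
    exact hs
  · exact DiagEq.subst s fun b => by
      cases b
      · exact (isIdem_var _).diagEq hu
      · exact (isIdem_var _).diagEq ht

/-! ### The quasi-order measuring the failure of a Maltsev term -/

variable (E)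

/-- Some ternary term `d` satisfies `d(x, y, y) ≈ x` and `d(x, x, y) ≈ u(x, y)`. -/
def IsReachable (u : Term L Bool) : Prop :=
  ∃ d : Term L (Fin 3),
    EqV E (d.subst ![.var true, .var false, .var false]) (.var true : Term L Bool) ∧
    EqV E (d.subst ![.var true, .var true, .var false]) u

/-- The largest compatible preorder on binary terms that preserves reachability and is contained
in `DiagEq`. -/
def Le : Term L Bool → Term L Bool → Prop :=
  Core fun u v => DiagEq E u v ∧ (IsReachable E u → IsReachable E v)

/-- The congruence associated with `Le`. -/
def Equ (u v : Term L Bool) : Prop := Le E u v ∧ Le E v u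

/-- The binary term `u` is equivalent to the second variable. -/
def IsLow (u : Term L Bool) : Prop := Equ E u (.var false)

variable {E}

theorem isVPreorder_le : IsVPreorder E (Le E) :=
  isVPreorder_core
    (fun _ _ h => ⟨.of_eqV h, fun ⟨d, hd, hd'⟩ => ⟨d, hd, hd'.trans h⟩⟩)
    fun _ _ _ h h' => ⟨h.1.trans h'.1, h'.2 ∘ h.2⟩

theorem isVCong_equ : IsVCong E (Equ E) := isVPreorder_le.isVCong_antisymm

theorem Le.diagEq {u v : Term L Bool} (h : Le E u v) : DiagEq E u v := (Core.le h).1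

theorem IsLow.isIdem {u : Term L Bool} (h : IsLow E u) : IsIdem E u :=
  (isIdem_var false).congr h.2.diagEq

theorem IsLow.equ {u v : Term L Bool} (hu : IsLow E u) (hv : IsLow E v) : Equ E u v :=
  isVCong_equ.trans hu (isVCong_equ.symm hv)

theorem EqV.isLow {u v : Term L Bool} (h : EqV E u v) (hv : IsLow E v) : IsLow E u :=
  isVCong_equ.trans (isVCong_equ.of_eqV h) hv

theorem isLow_var_false : IsLow E (.var false : Term L Bool) := isVCong_equ.refl _

/-- In an abelian variety the binary difference term attached to `d` is inverse to itself. -/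
theorem eqV_difference_cancel
    (hab : ∀ (A : Type) (I : Interp L A), InVariety E I → IsAbelian I) {d : Term L (Fin 3)}
    (hd : EqV E (d.subst ![.var true, .var false, .var false]) (.var true : Term L Bool)) :
    EqV E (d.subst ![d.subst ![.var true, .var true, .var false], .var false, .var true])
      (.var true : Term L Bool) := by
  have hd' : ∀ p q : Term L Bool, EqV E (d.subst ![p, q, q]) p := fun p q => by
    have := hd.subst fun b => bif b then p else q
    rw [Term.subst_subst] at this
    refine EqV.trans (EqV.subst_congr d fun i => ?_) this
    fin_cases i <;> exact .refl _
  have := isVCong_eqV.term_condition hab d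
    ![d.subst ![.var true, .var true, .var false], .var false, .var false]
    ![.var true, .var true, .var false]
    ![d.subst ![.var true, .var true, .var false], .var false, .var true]
    ![.var true, .var true, .var true]
    (fun i => by
      fin_cases i
      · exact .inr ⟨.refl _, .refl _⟩
      · exact .inr ⟨.refl _, .refl _⟩
      · exact .inl ⟨.refl _, .refl _⟩)
    (hd' _ _)
  exact this.trans (hd' _ _)

theorem le_var (hab : ∀ (A : Type) (I : Interp L A), InVariety E I → IsAbelian I) :
    Le E (.var false : Term L Bool) (.var true) := by
  intro c
  refine ⟨DiagEq.subst c fun o => ?_, ?_⟩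
  · cases o
    · exact (isIdem_var _).diagEq (isIdem_var _)
    · exact .refl _
  rintro ⟨d, hd, hd'⟩
  let p : Term L (Fin 3) :=
    c.subst fun o => o.elim (.var 1) fun b => bif b then .var 0 else .var 2
  have hp : ∀ b : Bool, p.subst ![.var true, .var b, .var false] = plug c (.var b) := fun b => by
    simp only [p, plug, Term.subst_subst]
    congr 1
    funext o
    rcases o with _ | (_ | _) <;> rfl
  refine ⟨d.subst ![p, .var 1, .var 0], ?_, ?_⟩
  · rw [Term.subst_subst]
    refine EqV.trans (EqV.subst_congr d fun i => ?_) (eqV_difference_cancel hab hd)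
    fin_cases i
    · change EqV E (p.subst _) _
      rw [hp]
      exact hd'.symm
    · exact .refl _
    · exact .refl _
  · rw [Term.subst_subst, ← hp true]
    have := hd.subst fun b => bif b then p.subst ![.var true, .var true, .var false]
      else (.var true : Term L Bool)
    rw [Term.subst_subst] at this
    refine EqV.trans (EqV.subst_congr d fun i => ?_) this
    fin_cases i <;> exact .refl _

/-- If the second variable is reachable, every algebra of the variety has a Maltsev operation. -/
theorem IsReachable.hasMaltsevPoly (h : IsReachable E (.var false : Term L Bool)) {A : Type}
    {I : Interp L A} (hI : InVariety E I) : HasMaltsevPoly I := by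
  obtain ⟨d, hd, hd'⟩ := h
  refine ⟨fun x => d.realize I x, ⟨0, d.subst fun i => .var (.inl i), Fin.elim0, fun x => ?_⟩,
    fun x y => ⟨?_, ?_⟩⟩
  · simp only [Term.realize_subst, Term.realize, Sum.elim_inl]
  · have := hd A I hI fun b => bif b then x else y
    rw [Term.realize_subst] at this
    refine Eq.trans ?_ this
    congr 1
    funext i
    fin_cases i <;> rfl
  · have := hd' A I hI fun b => bif b then y else x
    rw [Term.realize_subst] at this
    refine Eq.trans ?_ this
    congr 1
    funext i
    fin_cases i <;> rfl

theorem not_isLow_var_true (h : ¬ IsReachable E (.var false : Term L Bool)) :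
    ¬ IsLow E (.var true : Term L Bool) := fun hlow =>
  h ((Core.le hlow.1).2 ⟨.var 0, .refl _, .refl _⟩)

/-! ### Decisive multipliers -/

theorem Equ.eval₂_congr (s : Term L Bool) {h h' l l' : Term L Bool} (hh : Equ E h h')
    (hl : Equ E l l') : Equ E (s.eval₂ h l) (s.eval₂ h' l') :=
  isVCong_equ.subst s fun b => by cases b <;> assumption

theorem Le.eval₂_mono (s : Term L Bool) {h h' l l' : Term L Bool} (hh : Le E h h')
    (hl : Le E l l') : Le E (s.eval₂ h l) (s.eval₂ h' l') :=
  isVPreorder_le.subst s fun b => by cases b <;> assumption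

/-- Multiplication of a binary term by an idempotent one preserves equivalence to `y`. -/
theorem IsLow.mul {s t : Term L Bool} (hs : IsIdem E s) (ht : IsLow E t) :
    IsLow E (s.eval₂ t (.var false)) :=
  isVCong_equ.trans (Equ.eval₂_congr s ht (isVCong_equ.refl _))
    (isVCong_equ.of_eqV (hs.eval₂ _))

theorem IsIdem.var_false_le (hab : ∀ (A : Type) (I : Interp L A), InVariety E I → IsAbelian I)
    {u : Term L Bool} (hu : IsIdem E u) : Le E (.var false) u := by
  have := Le.eval₂_mono u (le_var hab) (isVPreorder_le.refl (.var false))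
  rw [Term.eval₂_self] at this
  exact isVPreorder_le.trans (isVPreorder_le.of_eqV (hu.eval₂ _).symm) this

theorem IsIdem.le_var_true (hab : ∀ (A : Type) (I : Interp L A), InVariety E I → IsAbelian I)
    {u : Term L Bool} (hu : IsIdem E u) : Le E u (.var true) := by
  have := Le.eval₂_mono u (isVPreorder_le.refl (.var true)) (le_var hab)
  rw [Term.eval₂_self] at this
  exact isVPreorder_le.trans this (isVPreorder_le.of_eqV (hu.eval₂ _))

theorem IsLow.of_le (hab : ∀ (A : Type) (I : Interp L A), InVariety E I → IsAbelian I)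
    {u v : Term L Bool} (huv : Le E u v) (hv : IsLow E v) : IsLow E u :=
  ⟨isVPreorder_le.trans huv hv.1, (hv.isIdem.congr huv.diagEq.symm).var_false_le hab⟩

theorem plug_eq_subst (c : Term L (Option Bool)) (u : Term L Bool) :
    plug c u = c.subst fun o => o.elim u fun b => bif b then .var true else .var false := by
  unfold plug
  congr 1
  funext o
  rcases o with _ | (_ | _) <;> rfl

/-- A context separating `a` from a larger `s` with respect to `IsLow` can be replaced by a
multiplication. -/
theorem exists_mul_separating
    (hab : ∀ (A : Type) (I : Interp L A), InVariety E I → IsAbelian I)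
    {a s : Term L Bool} (hs : IsIdem E s) (has : Le E a s) {c : Term L (Option Bool)}
    (hc : ¬ (IsLow E (plug c a) ↔ IsLow E (plug c s))) :
    ∃ m, IsIdem E m ∧ IsLow E (m.eval₂ a (.var false)) ∧
      ¬ IsLow E (m.eval₂ s (.var false)) := by
  have hle : Le E (plug c a) (plug c s) := isVPreorder_le.subst c fun o => by
    cases o
    · exact has
    · exact isVPreorder_le.refl _
  have hca : IsLow E (plug c a) := by
    by_contra h
    exact hc ⟨fun h' => absurd h' h, fun h' => h'.of_le hab hle⟩
  have hcs : ¬ IsLow E (plug c s) := fun h => hc ⟨fun _ => h, fun _ => hca⟩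
  let m : Term L Bool := c.subst fun o => o.elim (.var true) fun _ => .var false
  have hm : ∀ w : Term L Bool,
      m.eval₂ w (.var false) = c.subst fun o => o.elim w fun _ => .var false := fun w => by
    rw [Term.eval₂_subst]
    congr 1
    funext o
    cases o <;> rfl
  have hma : IsLow E (m.eval₂ a (.var false)) := by
    refine hca.of_le hab ?_
    rw [hm, plug_eq_subst]
    refine isVPreorder_le.subst c fun o => ?_
    rcases o with _ | (_ | _)
    · exact isVPreorder_le.refl _
    · exact isVPreorder_le.refl _
    · exact le_var hab
  have ha : IsIdem E a := hs.congr has.diagEq.symm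
  refine ⟨m, hma.isIdem.congr ?_, hma, fun hms => hcs ?_⟩
  · nth_rw 2 [← m.eval₂_self]
    exact DiagEq.subst m fun b => by
      cases b
      · exact .refl _
      · exact ha.diagEq (isIdem_var _)
  · have := isVCong_equ.term_condition hab c
      (fun o => o.elim a fun _ => .var false)
      (fun o => o.elim a fun b => bif b then .var true else .var false)
      (fun o => o.elim s fun _ => .var false)
      (fun o => o.elim s fun b => bif b then .var true else .var false)
      (fun o => by
        cases o
        · exact .inl ⟨isVCong_equ.refl _, isVCong_equ.refl _⟩
        · exact .inr ⟨isVCong_equ.refl _, isVCong_equ.refl _⟩)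
    rw [← plug_eq_subst, ← plug_eq_subst, ← hm, ← hm] at this
    exact isVCong_equ.trans (isVCong_equ.symm (this (hma.equ hca))) hms

theorem exists_mul_isLow
    (hab : ∀ (A : Type) (I : Interp L A), InVariety E I → IsAbelian I)
    {s r : Term L Bool} (hs : IsIdem E s) (hsl : ¬ IsLow E s) (hr : IsIdem E r) :
    ∃ m, IsIdem E m ∧ ¬ IsLow E (m.eval₂ s (.var false)) ∧
      (IsLow E (m.eval₂ (s.eval₂ r (.var false)) (.var false)) ∨
        IsLow E (m.eval₂ (s.eval₂ (r.eval₂ (.var false) (.var true)) (.var false))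
          (.var false))) := by
  by_cases hsr : IsLow E (s.eval₂ r (.var false))
  · exact ⟨.var true, isIdem_var _, hsl, .inl hsr⟩
  have hψ : IsVCong E (Core fun u v : Term L Bool => (IsLow E u ↔ IsLow E v)) :=
    isVCong_core (fun _ _ h => ⟨h.symm.isLow, h.isLow⟩) (fun _ _ _ => Iff.trans)
      fun _ _ => Iff.symm
  have hr' : IsIdem E (r.eval₂ (.var false) (.var true) : Term L Bool) :=
    hr.eval₂_isIdem (isIdem_var _) (isIdem_var _)
  have hsep : ¬ Core (fun u v : Term L Bool => (IsLow E u ↔ IsLow E v))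
      (s.eval₂ (r.eval₂ (.var false) (.var true)) (.var false)) s := by
    intro h
    let t : Term L (Fin 3) := s.eval₂ (r.eval₂ (.var 0) (.var 1)) (.var 2)
    have ht : ∀ w v u : Term L Bool, t.subst ![w, v, u] = s.eval₂ (r.eval₂ w v) u :=
      fun w v u => by
        simp only [t, Term.subst_eval₂, Term.subst_var]
        rfl
    have h00 : EqV E (t.subst ![.var true, .var true, .var false]) s := by
      rw [ht]
      nth_rw 2 [← s.eval₂_self]
      exact EqV.subst_congr s fun b => by
        cases b
        · exact .refl _
        · exact hr.eval₂ _
    have h11 : IsLow E (t.subst ![.var false, .var false, .var false]) := by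
      rw [ht]
      exact IsLow.mul hs ((hr.eval₂ _).isLow isLow_var_false)
    have := hψ.term_condition hab t
      ![.var false, .var true, .var false] ![.var true, .var true, .var false]
      ![.var false, .var false, .var false] ![.var true, .var false, .var false]
      (fun i => by
        fin_cases i
        · exact .inr ⟨hψ.refl _, hψ.refl _⟩
        · exact .inl ⟨hψ.refl _, hψ.refl _⟩
        · exact .inl ⟨hψ.refl _, hψ.refl _⟩)
      (hψ.trans (by rwa [ht]) (hψ.of_eqV h00.symm))
    have h10 := this.le.1 h11
    rw [ht, Term.eval₂_self] at h10
    exact hsr h10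
  obtain ⟨c, hc⟩ := not_forall.1 hsep
  have hle : Le E (s.eval₂ (r.eval₂ (.var false) (.var true)) (.var false)) s := by
    have := Le.eval₂_mono s (hr'.le_var_true hab) (isVPreorder_le.refl (.var false))
    rwa [Term.eval₂_self] at this
  obtain ⟨m, hm, hma, hms⟩ := exists_mul_separating hab hs hle hc
  exact ⟨m, hm, hms, .inr hma⟩

theorem exists_mul_isLow_finset
    (hab : ∀ (A : Type) (I : Interp L A), InVariety E I → IsAbelian I)
    (hm : ¬ IsReachable E (.var false : Term L Bool))
    (F : Finset {r : Term L Bool // IsIdem E r}) :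
    ∃ s, (IsIdem E s ∧ ¬ IsLow E s) ∧ ∀ r ∈ F, IsLow E (s.eval₂ r.1 (.var false)) ∨
      IsLow E (s.eval₂ (r.1.eval₂ (.var false) (.var true)) (.var false)) := by
  classical
  induction F using Finset.induction_on with
  | empty => exact ⟨.var true, ⟨isIdem_var _, not_isLow_var_true hm⟩, by simp⟩
  | insert r F hr ih =>
    obtain ⟨s, ⟨hs, hsl⟩, hF⟩ := ih
    obtain ⟨m, hm, hms, hmr⟩ := exists_mul_isLow hab hs hsl r.2
    have assoc : ∀ u : Term L Bool, (m.eval₂ s (.var false)).eval₂ u (.var false) =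
        m.eval₂ (s.eval₂ u (.var false)) (.var false) := fun u => m.eval₂_eval₂ _ _ _ _
    refine ⟨m.eval₂ s (.var false), ⟨hm.eval₂_isIdem hs (isIdem_var _), hms⟩, fun r' hr' => ?_⟩
    rw [assoc, assoc]
    rcases Finset.mem_insert.1 hr' with rfl | hr'
    · exact hmr
    · exact (hF r' hr').imp (IsLow.mul hm) (IsLow.mul hm)

/-- An ultrafilter of nontrivial idempotent binary terms is decisive if almost all of its
members annihilate one of the two coefficients of any given idempotent binary term. -/
structure IsDecisive (E : Set (Term L ℕ × Term L ℕ)) (U : Ultrafilter (Term L Bool)) : Prop where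
  isIdem : ∀ᶠ s : Term L Bool in U, IsIdem E s
  not_isLow : ∀ᶠ s : Term L Bool in U, ¬ IsLow E s
  decisive : ∀ r, IsIdem E r → ∀ᶠ s : Term L Bool in U, IsLow E (s.eval₂ r (.var false)) ∨
    IsLow E (s.eval₂ (r.eval₂ (.var false) (.var true)) (.var false))

theorem exists_isDecisive
    (hab : ∀ (A : Type) (I : Interp L A), InVariety E I → IsAbelian I)
    (hm : ¬ IsReachable E (.var false : Term L Bool)) :
    ∃ U : Ultrafilter (Term L Bool), IsDecisive E U := by
  choose s hs hF using exists_mul_isLow_finset hab hm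
  have hU : ∀ {P : Term L Bool → Prop}, (∀ᶠ F in Filter.atTop, P (s F)) →
      ∀ᶠ t in Ultrafilter.map s (Ultrafilter.of Filter.atTop), P t :=
    fun h => h.filter_mono (Ultrafilter.of_le Filter.atTop)
  exact ⟨_, hU (.of_forall fun F => (hs F).1), hU (.of_forall fun F => (hs F).2),
    fun r hr => hU ((Filter.eventually_ge_atTop {⟨r, hr⟩}).mono fun F h =>
      hF F ⟨r, hr⟩ (h (Finset.mem_singleton_self _)))⟩

/-! ### Annihilated blocks of variables -/

theorem isLow_subst_of_block
    (hab : ∀ (A : Type) (I : Interp L A), InVariety E I → IsAbelian I)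
    {Z : Type} (t : Term L Z) (J : Z → Bool) {σ τ : Z → Term L Bool}
    (h : ∀ z, DiagEq E (τ z) (σ z))
    (hlow : IsLow E (t.subst fun z => (σ z).eval₂ (.var (J z)) (.var (J z)))) :
    IsLow E (t.subst fun z => (τ z).eval₂ (.var (J z)) (.var false)) := by
  refine hlow.of_le hab (isVPreorder_le.trans (isVPreorder_le.subst t fun z => ?_)
    (isVPreorder_le.of_eqV (EqV.subst_congr t fun z => (h z).eval₂ (.var (J z)))))
  refine Le.eval₂_mono _ (isVPreorder_le.refl _) ?_
  cases J z
  · exact isVPreorder_le.refl _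
  · exact le_var hab

/-- If the block `J` of variables of `t` is annihilated, then `t` does not depend on it. -/
theorem equ_of_isLow_block
    (hab : ∀ (A : Type) (I : Interp L A), InVariety E I → IsAbelian I)
    {Z : Type} (t : Term L Z) (J : Z → Bool) {σ τ τ' : Z → Term L Bool}
    (h : ∀ z, DiagEq E (τ z) (σ z)) (h' : ∀ z, DiagEq E (τ' z) (σ z))
    (hJ : ∀ z, J z = false → τ z = τ' z)
    (hlow : IsLow E (t.subst fun z => (σ z).eval₂ (.var (J z)) (.var (J z)))) :
    Equ E (t.subst τ) (t.subst τ') := by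
  refine isVCong_equ.term_condition hab t _ _ _ _ (fun z => ?_)
    ((isLow_subst_of_block hab t J h hlow).equ (isLow_subst_of_block hab t J h' hlow))
  cases hz : J z with
  | false => rw [hJ z hz]; exact .inl ⟨isVCong_equ.refl _, isVCong_equ.refl _⟩
  | true =>
    simp only [Term.eval₂_self]
    exact .inr ⟨isVCong_equ.refl _, isVCong_equ.refl _⟩

theorem mul_equ_of_isLow_block
    (hab : ∀ (A : Type) (I : Interp L A), InVariety E I → IsAbelian I)
    (s : Term L Bool) {Z : Type} (t : Term L Z) (J : Z → Bool) {σ τ τ' : Z → Term L Bool}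
    (h : ∀ z, DiagEq E (τ z) (σ z)) (h' : ∀ z, DiagEq E (τ' z) (σ z))
    (hJ : ∀ z, J z = false → τ z = τ' z)
    (hlow : IsLow E (s.eval₂ (t.subst fun z => (σ z).eval₂ (.var (J z)) (.var (J z)))
      (.var false))) :
    Equ E (s.eval₂ (t.subst τ) (.var false)) (s.eval₂ (t.subst τ') (.var false)) := by
  let t' : Term L (Option Z) := s.eval₂ (t.subst fun z => .var (some z)) (.var none)
  have ht' : ∀ ρ : Option Z → Term L Bool,
      t'.subst ρ = s.eval₂ (t.subst fun z => ρ (some z)) (ρ none) := fun ρ => by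
    simp only [t', Term.subst_eval₂, Term.subst_subst, Term.subst_var]
  have := equ_of_isLow_block hab t' (fun o => o.elim false J)
    (σ := fun o => o.elim (.var false) σ) (τ := fun o => o.elim (.var false) τ)
    (τ' := fun o => o.elim (.var false) τ')
    (fun o => by cases o with
      | none => exact .refl _
      | some z => exact h z)
    (fun o => by cases o with
      | none => exact .refl _
      | some z => exact h' z)
    (fun o ho => by cases o with
      | none => rfl
      | some z => exact hJ z ho)
    (by rw [ht']; exact hlow)
  rwa [ht', ht'] at this

theorem eventually_mul_equ
    (hab : ∀ (A : Type) (I : Interp L A), InVariety E I → IsAbelian I)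
    {U : Ultrafilter (Term L Bool)} (hU : IsDecisive E U)
    {Z : Type} (t : Term L Z) (J : Z → Bool) {σ₀₀ σ₀₁ σ₁₀ σ₁₁ : Z → Term L Bool}
    (h₀₁ : ∀ z, DiagEq E (σ₀₁ z) (σ₀₀ z)) (h₁₀ : ∀ z, DiagEq E (σ₁₀ z) (σ₀₀ z))
    (h₁₁ : ∀ z, DiagEq E (σ₁₁ z) (σ₀₀ z))
    (hJ : ∀ z, J z = false → σ₁₀ z = σ₁₁ z)
    (hJ' : ∀ z, J z = true → σ₀₀ z = σ₁₀ z ∧ σ₀₁ z = σ₁₁ z)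
    (ht : IsIdem E (t.subst σ₀₀)) :
    (∀ᶠ s : Term L Bool in U, Equ E (s.eval₂ (t.subst σ₁₀) (.var false))
      (s.eval₂ (t.subst σ₁₁) (.var false))) ∨
    ∀ᶠ s : Term L Bool in U, Equ E (s.eval₂ (t.subst σ₀₀) (.var false))
        (s.eval₂ (t.subst σ₁₀) (.var false)) ∧
      Equ E (s.eval₂ (t.subst σ₀₁) (.var false)) (s.eval₂ (t.subst σ₁₁) (.var false)) := by
  have hD : IsIdem E (t.subst fun z => (σ₀₀ z).eval₂ (.var (J z)) (.var (J z))) := by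
    refine ht.congr (DiagEq.subst t fun z => ?_)
    unfold DiagEq
    rw [Term.eval₂_eval₂]
    cases J z <;> exact .refl _
  refine (Ultrafilter.eventually_or.1 (hU.decisive _ hD)).imp (fun h => ?_) fun h => ?_
  · exact h.mono fun s hs => mul_equ_of_isLow_block hab s t J h₁₀ h₁₁ hJ hs
  · refine h.mono fun s hs => ?_
    have hs' : IsLow E (s.eval₂ (t.subst fun z =>
        (σ₀₀ z).eval₂ (.var (!J z)) (.var (!J z))) (.var false)) := by
      rw [Term.eval₂_subst] at hs
      simp only [Term.eval₂_eval₂] at hs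
      convert hs using 5 with z z
      all_goals cases J z <;> rfl
    have hJ'' : ∀ z, (!J z) = false → J z = true := fun z hz => by simpa using hz
    exact ⟨mul_equ_of_isLow_block hab s t _ (fun z => .refl _) h₁₀
        (fun z hz => (hJ' z (hJ'' z hz)).1) hs',
      mul_equ_of_isLow_block hab s t _ h₀₁ h₁₁ (fun z hz => (hJ' z (hJ'' z hz)).2) hs'⟩

/-! ### The strongly abelian congruence -/

/-- Terms have the same diagonal and, in every idempotent context, almost all multiples agree. -/
def UltraEqu (E : Set (Term L ℕ × Term L ℕ)) (U : Ultrafilter (Term L Bool)) :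
    Term L Bool → Term L Bool → Prop :=
  Core fun u v => DiagEq E u v ∧
    (IsIdem E u →
      ∀ᶠ s : Term L Bool in U, Equ E (s.eval₂ u (.var false)) (s.eval₂ v (.var false)))

theorem isVCong_ultraEqu (U : Ultrafilter (Term L Bool)) : IsVCong E (UltraEqu E U) := by
  refine isVCong_core (fun s t h => ⟨.of_eqV h, fun _ => .of_forall fun m => ?_⟩)
    (fun s t u h h' => ⟨h.1.trans h'.1, fun hs => ?_⟩)
    fun s t h => ⟨h.1.symm, fun ht => ?_⟩
  · exact Equ.eval₂_congr m (isVCong_equ.of_eqV h) (isVCong_equ.refl _)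
  · filter_upwards [h.2 hs, h'.2 (hs.congr h.1)] with m hm hm'
    exact isVCong_equ.trans hm hm'
  · filter_upwards [h.2 (ht.congr h.1.symm)] with m hm
    exact isVCong_equ.symm hm

theorem UltraEqu.diagEq {U : Ultrafilter (Term L Bool)} {u v : Term L Bool}
    (h : UltraEqu E U u v) : DiagEq E u v := (Core.le h).1

theorem IsDecisive.not_ultraEqu {U : Ultrafilter (Term L Bool)} (hU : IsDecisive E U) :
    ¬ UltraEqu E U (.var true) (.var false) := by
  intro h
  obtain ⟨s, hs, hsl, hse⟩ :=
    (hU.isIdem.and (hU.not_isLow.and ((Core.le h).2 (isIdem_var _)))).exists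
  rw [Term.eval₂_self] at hse
  exact hsl (isVCong_equ.trans hse (isVCong_equ.of_eqV (hs.eval₂ _)))

theorem ultraEqu_of_matrix
    (hab : ∀ (A : Type) (I : Interp L A), InVariety E I → IsAbelian I)
    {U : Ultrafilter (Term L Bool)} (hU : IsDecisive E U)
    {Z : Type} (t : Term L Z) (J : Z → Bool) {σ₀₀ σ₀₁ σ₁₀ σ₁₁ : Z → Term L Bool}
    (h₀₁ : ∀ z, DiagEq E (σ₀₁ z) (σ₀₀ z)) (h₁₀ : ∀ z, DiagEq E (σ₁₀ z) (σ₀₀ z))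
    (h₁₁ : ∀ z, DiagEq E (σ₁₁ z) (σ₀₀ z))
    (hJ : ∀ z, J z = false → σ₁₀ z = σ₁₁ z)
    (hJ' : ∀ z, J z = true → σ₀₀ z = σ₁₀ z ∧ σ₀₁ z = σ₁₁ z)
    (h : UltraEqu E U (t.subst σ₀₀) (t.subst σ₀₁) ∨ UltraEqu E U (t.subst σ₀₁) (t.subst σ₁₀)) :
    UltraEqu E U (t.subst σ₁₀) (t.subst σ₁₁) := by
  intro c
  let t' : Term L (Z ⊕ Bool) :=
    c.subst fun o => o.elim (t.subst fun z => .var (.inl z)) fun b => .var (.inr b)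
  have ht' : ∀ σ : Z → Term L Bool,
      t'.subst (Sum.elim σ .var) = plug c (t.subst σ) := fun σ => by
    simp only [t', plug, Term.subst_subst]
    congr 1
    funext o
    cases o with
    | none => simp only [Option.elim, Term.subst_subst, Term.subst_var, Sum.elim_inl]
    | some b => rfl
  have elim : ∀ {σ τ : Z → Term L Bool}, (∀ z, DiagEq E (σ z) (τ z)) →
      ∀ z : Z ⊕ Bool, DiagEq E (Sum.elim σ .var z) (Sum.elim τ .var z) := fun hστ z => by
    cases z with
    | inl z => exact hστ z
    | inr b => exact .refl _
  have hdiag : ∀ {σ τ : Z → Term L Bool}, (∀ z, DiagEq E (σ z) (τ z)) →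
      DiagEq E (plug c (t.subst σ)) (plug c (t.subst τ)) := fun {σ τ} hστ => by
    rw [← ht', ← ht']
    exact DiagEq.subst t' (elim hστ)
  refine ⟨hdiag fun z => (h₁₀ z).trans (h₁₁ z).symm, fun hidem => ?_⟩
  have hidem₀₀ := hidem.congr (hdiag h₁₀)
  have key := eventually_mul_equ hab hU t' (Sum.elim J fun _ => false) (elim h₀₁) (elim h₁₀)
    (elim h₁₁)
    (fun z hz => by cases z with
      | inl z => exact hJ z hz
      | inr b => rfl)
    (fun z hz => by cases z with
      | inl z => exact hJ' z hz
      | inr b => exact absurd hz Bool.false_ne_true)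
    (by rwa [ht'])
  simp only [ht'] at key
  rcases key with key | key
  · exact key
  rcases h with h | h
  · filter_upwards [key, (h c).2 hidem₀₀] with s hs hs'
    exact isVCong_equ.trans (isVCong_equ.symm hs.1) (isVCong_equ.trans hs' hs.2)
  · filter_upwards [key, (h c).2 (hidem₀₀.congr (hdiag h₀₁).symm)] with s hs hs'
    exact isVCong_equ.trans (isVCong_equ.symm hs') hs.2

end Binary

/-- If every member of the variety `Mod(E)` is abelian and some member is
not affine (has no Maltsev polynomial operation), then some member of `Mod(E)` has a
nontrivial strongly abelian congruence. -/
theorem statement0 {L : Lang} (E : Set (Term L ℕ × Term L ℕ))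
    (habelian : ∀ (A : Type) (I : Interp L A), InVariety E I → IsAbelian I)
    (hnotaffine : ∃ (A : Type) (I : Interp L A), InVariety E I ∧ ¬ HasMaltsevPoly I) :
    ∃ (B : Type) (J : Interp L B) (θ : B → B → Prop),
      InVariety E J ∧ IsCong J θ ∧ (∃ x y : B, θ x y ∧ x ≠ y) ∧
      IsStronglyAbelianCong J θ := by
  obtain ⟨A, I, hI, hA⟩ := hnotaffine
  obtain ⟨U, hU⟩ := exists_isDecisive habelian fun h => hA (h.hasMaltsevPoly hI)
  have hβ : IsVCong E (UltraEqu E U) := isVCong_ultraEqu U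
  refine ⟨Quot (UltraEqu E U), quotInterp (termInterp L Bool) (UltraEqu E U),
    fun x y => DiagEq E x.out y.out, hβ.inVariety,
    ⟨⟨fun _ => .refl _, .symm, .trans⟩, fun f a b h => ?_⟩,
    ⟨Quot.mk _ (.var true), Quot.mk _ (.var false), ?_, fun h => ?_⟩, ?_⟩
  · exact (hβ.out_mk _).diagEq.trans
      ((DiagEq.subst (.app f .var) h).trans (hβ.out_mk _).diagEq.symm)
  · exact (hβ.out_mk _).diagEq.trans
      (((isIdem_var _).diagEq (isIdem_var _)).trans (hβ.out_mk _).diagEq.symm)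
  · exact hU.not_ultraEqu (hβ.mk_eq_mk.1 h)
  · rintro p q r s ⟨k, l, t, ⟨m, T, c, hT⟩, a, b, u, v, hab, huv, rfl, rfl, rfl, rfl⟩
    simp only [hT, hβ.realize_eq, hβ.mk_eq_mk]
    have key := ultraEqu_of_matrix habelian hU T
      (Sum.elim (Sum.elim (fun _ => false) fun _ => true) fun _ => false)
      (σ₀₀ := fun z => (Sum.elim (Sum.elim a u) c z).out)
      (σ₀₁ := fun z => (Sum.elim (Sum.elim a v) c z).out)
      (σ₁₀ := fun z => (Sum.elim (Sum.elim b u) c z).out)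
      (σ₁₁ := fun z => (Sum.elim (Sum.elim b v) c z).out)
      (by
        rintro ((i | j) | n)
        exacts [.refl _, (huv j).symm, .refl _])
      (by
        rintro ((i | j) | n)
        exacts [(hab i).symm, .refl _, .refl _])
      (by
        rintro ((i | j) | n)
        exacts [(hab i).symm, (huv j).symm, .refl _])
      (by rintro ((i | j) | n) hz <;> first | rfl | cases hz)
      (by rintro ((i | j) | n) hz <;> first | exact ⟨rfl, rfl⟩ | cases hz)
    exact ⟨fun h => key (.inl h), fun h => key (.inr h)⟩

end UA
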